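/- arXiv:2307.04609 — 4 statements merged into one kernel-verified Lean document; each statement's English description precedes it below -/
import Mathlib

section
/- Let V₁, V₂ be real vector spaces carrying algebraic almost contact structures (φ₁, η₁, ξ₁) and (φ₂, η₂, ξ₂), and let a, b ∈ ℝ with b ≠ 0. Define the linear endomorphism J_{a,b} of V₁ × V₂ by J_{a,b}(X₁, X₂) := (φ₁(X₁) − ((a/b)·η₁(X₁) + ((a²+b²)/b)·η₂(X₂))·ξ₁, φ₂(X₂) + ((1/b)·η₁(X₁) + (a/b)·η₂(X₂))·ξ₂). Then J_{a,b} ∘ J_{a,b} = −id. -/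
/-- An algebraic almost contact structure on a real vector space `V`:
a triple `(φ, η, ξ)` with `φ` a linear endomorphism of `V`, `η` a linear
functional on `V`, and `ξ ∈ V`, satisfying `η ∘ φ = 0`,
`φ ∘ φ = −id + (x ↦ η(x)·ξ)`, `η(ξ) = 1`, and `φ(ξ) = 0`. -/
structure AlgAlmostContact (V : Type*) [AddCommGroup V] [Module ℝ V] where
  φ : V →ₗ[ℝ] V
  η : V →ₗ[ℝ] ℝ
  ξ : V
  eta_phi : ∀ x, η (φ x) = 0
  phi_phi : ∀ x, φ (φ x) = -x + η x • ξ
  eta_xi : η ξ = 1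
  phi_xi : φ ξ = 0

/-- the Calabi-Eckmann-Morimoto endomorphism `J_{a,b}` on the
product of two algebraic almost contact structures squares to `−id`. -/
theorem CEM_J_sq_eq_neg_id {V₁ V₂ : Type*}
    [AddCommGroup V₁] [Module ℝ V₁] [AddCommGroup V₂] [Module ℝ V₂]
    (S₁ : AlgAlmostContact V₁) (S₂ : AlgAlmostContact V₂)
    (a b : ℝ) (hb : b ≠ 0)
    (J : (V₁ × V₂) →ₗ[ℝ] (V₁ × V₂))
    (hJ : ∀ (X₁ : V₁) (X₂ : V₂),
      J (X₁, X₂) =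
        (S₁.φ X₁ - ((a / b) * S₁.η X₁ + ((a ^ 2 + b ^ 2) / b) * S₂.η X₂) • S₁.ξ,
         S₂.φ X₂ + ((1 / b) * S₁.η X₁ + (a / b) * S₂.η X₂) • S₂.ξ)) :
    J ∘ₗ J = -LinearMap.id := by
  refine LinearMap.ext fun ⟨X₁, X₂⟩ => ?_
  simp only [LinearMap.comp_apply, LinearMap.neg_apply, LinearMap.id_apply, hJ, Prod.neg_mk,
    map_sub, map_add, map_smul, S₁.eta_phi, S₂.eta_phi, S₁.phi_phi, S₂.phi_phi, S₁.eta_xi,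
    S₂.eta_xi, S₁.phi_xi, S₂.phi_xi, smul_eq_mul, Prod.mk.injEq]
  constructor
  · match_scalars <;> field_simp
    ring
  · match_scalars <;> field_simp
    ring
end

section
/- Let V₁, V₂ be real vector spaces carrying algebraic almost contact structures (φ₁, η₁, ξ₁) and (φ₂, η₂, ξ₂) with compatible metrics g₁, g₂, and let a, b ∈ ℝ with b ≠ 0. Define on V₁ × V₂ the bilinear form g_{a,b}((X₁,X₂),(Y₁,Y₂)) := g₁(X₁,Y₁) + a·η₁(X₁)·η₂(Y₂) + a·η₁(Y₁)·η₂(X₂) + (a²+b²−1)·η₂(X₂)·η₂(Y₂) + g₂(X₂,Y₂), and the endomorphism J_{a,b}(X₁, X₂) := (φ₁(X₁) − ((a/b)·η₁(X₁) + ((a²+b²)/b)·η₂(X₂))·ξ₁, φ₂(X₂) + ((1/b)·η₁(X₁) + (a/b)·η₂(X₂))·ξ₂). Then g_{a,b} is symmetric and g_{a,b}(J_{a,b}X, J_{a,b}Y) = g_{a,b}(X, Y) for all X, Y ∈ V₁ × V₂. -/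
/-- A compatible metric for an algebraic almost contact structure `(φ, η, ξ)`:
a symmetric positive-definite bilinear form `g` with `η(x) = g(x, ξ)` and
`g(φx, φy) = g(x,y) − η(x)·η(y)`. -/
structure CompatibleMetric {V : Type*} [AddCommGroup V] [Module ℝ V]
    (S : AlgAlmostContact V) where
  g : V →ₗ[ℝ] V →ₗ[ℝ] ℝ
  symm : ∀ x y, g x y = g y x
  posdef : ∀ x, x ≠ 0 → 0 < g x x
  eta_eq : ∀ x, S.η x = g x S.ξ
  compat : ∀ x y, g (S.φ x) (S.φ y) = g x y - S.η x * S.η y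

/-- The functional `η` reads off the `ξ`-coefficient of `φ x + s • ξ`. -/
theorem AlgAlmostContact.eta_phi_add_smul_xi {V : Type*} [AddCommGroup V] [Module ℝ V]
    (S : AlgAlmostContact V) (x : V) (s : ℝ) : S.η (S.φ x + s • S.ξ) = s := by
  simp [S.eta_phi, S.eta_xi]

/-- A compatible metric evaluated on vectors of the form `φ x + s • ξ`. -/
theorem CompatibleMetric.apply_phi_add_smul_xi {V : Type*} [AddCommGroup V] [Module ℝ V]
    {S : AlgAlmostContact V} (G : CompatibleMetric S) (x y : V) (s t : ℝ) :
    G.g (S.φ x + s • S.ξ) (S.φ y + t • S.ξ) = G.g x y - S.η x * S.η y + s * t := by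
  have h_phi_xi (z : V) : G.g (S.φ z) S.ξ = 0 := by rw [← G.eta_eq, S.eta_phi]
  have h_xi_phi (z : V) : G.g S.ξ (S.φ z) = 0 := by rw [G.symm, h_phi_xi]
  have h_xi_xi : G.g S.ξ S.ξ = 1 := by rw [← G.eta_eq, S.eta_xi]
  simp [h_phi_xi, h_xi_phi, h_xi_xi, G.compat]

/-- the Calabi-Eckmann-Morimoto bilinear form `g_{a,b}` on the
product is symmetric and Hermitian with respect to `J_{a,b}`. -/
theorem CEM_metric_symm_and_hermitian {V₁ V₂ : Type*}
    [AddCommGroup V₁] [Module ℝ V₁] [AddCommGroup V₂] [Module ℝ V₂]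
    (S₁ : AlgAlmostContact V₁) (S₂ : AlgAlmostContact V₂)
    (G₁ : CompatibleMetric S₁) (G₂ : CompatibleMetric S₂)
    (a b : ℝ) (hb : b ≠ 0)
    (g : V₁ × V₂ → V₁ × V₂ → ℝ)
    (hg : ∀ (X₁ Y₁ : V₁) (X₂ Y₂ : V₂),
      g (X₁, X₂) (Y₁, Y₂) =
        G₁.g X₁ Y₁ + a * S₁.η X₁ * S₂.η Y₂ + a * S₁.η Y₁ * S₂.η X₂
          + (a ^ 2 + b ^ 2 - 1) * S₂.η X₂ * S₂.η Y₂ + G₂.g X₂ Y₂)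
    (J : (V₁ × V₂) →ₗ[ℝ] (V₁ × V₂))
    (hJ : ∀ (X₁ : V₁) (X₂ : V₂),
      J (X₁, X₂) =
        (S₁.φ X₁ - ((a / b) * S₁.η X₁ + ((a ^ 2 + b ^ 2) / b) * S₂.η X₂) • S₁.ξ,
         S₂.φ X₂ + ((1 / b) * S₁.η X₁ + (a / b) * S₂.η X₂) • S₂.ξ)) :
    (∀ X Y : V₁ × V₂, g X Y = g Y X) ∧
      (∀ X Y : V₁ × V₂, g (J X) (J Y) = g X Y) := by
  refine ⟨?_, ?_⟩
  · rintro ⟨X₁, X₂⟩ ⟨Y₁, Y₂⟩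
    rw [hg, hg, G₁.symm X₁ Y₁, G₂.symm X₂ Y₂]
    ring
  · rintro ⟨X₁, X₂⟩ ⟨Y₁, Y₂⟩
    rw [hJ, hJ, hg, hg, sub_eq_add_neg, sub_eq_add_neg, ← neg_smul, ← neg_smul,
      G₁.apply_phi_add_smul_xi, G₂.apply_phi_add_smul_xi]
    simp only [S₁.eta_phi_add_smul_xi, S₂.eta_phi_add_smul_xi]
    field_simp
    ring
end

section
/- Let V₁, V₂ be real vector spaces carrying algebraic almost contact structures (φ₁, η₁, ξ₁) and (φ₂, η₂, ξ₂) with compatible metrics g₁, g₂, and let a, b ∈ ℝ with b ≠ 0. Then the bilinear form on V₁ × V₂ given by g_{a,b}((X₁,X₂),(Y₁,Y₂)) := g₁(X₁,Y₁) + a·η₁(X₁)·η₂(Y₂) + a·η₁(Y₁)·η₂(X₂) + (a²+b²−1)·η₂(X₂)·η₂(Y₂) + g₂(X₂,Y₂) is positive definite. -/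
theorem CompatibleMetric.self_nonneg {V : Type*} [AddCommGroup V] [Module ℝ V]
    {S : AlgAlmostContact V} (G : CompatibleMetric S) (x : V) : 0 ≤ G.g x x := by
  rcases eq_or_ne x 0 with rfl | hx
  · simp
  · exact (G.posdef x hx).le

theorem CompatibleMetric.eta_sq_le {V : Type*} [AddCommGroup V] [Module ℝ V]
    {S : AlgAlmostContact V} (G : CompatibleMetric S) (x : V) : S.η x ^ 2 ≤ G.g x x := by
  have h := G.self_nonneg (S.φ x)
  rw [G.compat] at h
  linarith

/-- the Calabi-Eckmann-Morimoto bilinear form `g_{a,b}` on the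
product of two algebraic almost contact structures with compatible metrics
is positive definite. -/
theorem CEM_metric_posdef {V₁ V₂ : Type*}
    [AddCommGroup V₁] [Module ℝ V₁] [AddCommGroup V₂] [Module ℝ V₂]
    (S₁ : AlgAlmostContact V₁) (S₂ : AlgAlmostContact V₂)
    (G₁ : CompatibleMetric S₁) (G₂ : CompatibleMetric S₂)
    (a b : ℝ) (hb : b ≠ 0)
    (g : V₁ × V₂ → V₁ × V₂ → ℝ)
    (hg : ∀ (X₁ Y₁ : V₁) (X₂ Y₂ : V₂),
      g (X₁, X₂) (Y₁, Y₂) =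
        G₁.g X₁ Y₁ + a * S₁.η X₁ * S₂.η Y₂ + a * S₁.η Y₁ * S₂.η X₂
          + (a ^ 2 + b ^ 2 - 1) * S₂.η X₂ * S₂.η Y₂ + G₂.g X₂ Y₂) :
    ∀ X : V₁ × V₂, X ≠ 0 → 0 < g X X := by
  rintro ⟨x, y⟩ hxy
  rw [hg]
  have hx := G₁.eta_sq_le x
  have hy := G₂.eta_sq_le y
  by_cases hη : S₂.η y = 0
  · simp only [hη, mul_zero, add_zero]
    by_cases hx0 : x = 0
    · have hy0 : y ≠ 0 := fun h => hxy (by rw [hx0, h, Prod.mk_zero_zero])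
      exact add_pos_of_nonneg_of_pos (G₁.self_nonneg x) (G₂.posdef y hy0)
    · exact add_pos_of_pos_of_nonneg (G₁.posdef x hx0) (G₂.self_nonneg y)
  · have hpos : 0 < (b * S₂.η y) ^ 2 := by positivity
    linarith [sq_nonneg (S₁.η x + a * S₂.η y)]
end

section
/- Let V₁, V₂ be real vector spaces carrying algebraic almost contact structures (φ₁, η₁, ξ₁) and (φ₂, η₂, ξ₂), and let a, b ∈ ℝ with b ≠ 0. Define the linear endomorphism J of V₁ × V₂ by J(X₁, X₂) := (φ₁(X₁) + (1/b)·(a·η₁(X₁) − η₂(X₂))·ξ₁, φ₂(X₂) + (1/b)·((a²+b²)·η₁(X₁) − a·η₂(X₂))·ξ₂). Then J ∘ J = −id. -/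
/-- the endomorphism `J` induced on the product of two algebraic
almost contact structures by the `G_α`-quotient of the product of the Kähler
cones (with `a = Re α`, `b = Im α`) squares to `−id`. -/
theorem Galpha_J_sq_eq_neg_id {V₁ V₂ : Type*}
    [AddCommGroup V₁] [Module ℝ V₁] [AddCommGroup V₂] [Module ℝ V₂]
    (S₁ : AlgAlmostContact V₁) (S₂ : AlgAlmostContact V₂)
    (a b : ℝ) (hb : b ≠ 0)
    (J : (V₁ × V₂) →ₗ[ℝ] (V₁ × V₂))
    (hJ : ∀ (X₁ : V₁) (X₂ : V₂),
      J (X₁, X₂) =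
        (S₁.φ X₁ + ((1 / b) * (a * S₁.η X₁ - S₂.η X₂)) • S₁.ξ,
         S₂.φ X₂ + ((1 / b) * ((a ^ 2 + b ^ 2) * S₁.η X₁ - a * S₂.η X₂)) • S₂.ξ)) :
    J ∘ₗ J = -LinearMap.id := by
  refine LinearMap.ext fun ⟨X₁, X₂⟩ => ?_
  rw [LinearMap.comp_apply, hJ, hJ]
  simp only [map_add, map_smul, S₁.eta_phi, S₁.phi_phi, S₁.eta_xi, S₁.phi_xi,
    S₂.eta_phi, S₂.phi_phi, S₂.eta_xi, S₂.phi_xi, smul_eq_mul, smul_zero, add_zero, zero_add,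
    mul_one, LinearMap.neg_apply, LinearMap.id_apply, Prod.neg_mk, add_assoc, ← add_smul]
  refine Prod.ext ?_ ?_ <;>
  · refine add_eq_left.mpr (smul_eq_zero_of_left ?_ _)
    field_simp
    ring
end
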